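/- arXiv:2302.06809 — 2 statements merged into one kernel-verified Lean document; each statement's English description precedes it below -/
import Mathlib

section
/- There exists a universal constant μ0 > 0 such that for every μ∈(0,μ0), every π0∈(0,1) with π1=1−π0, and every z∈ℝ: Φ(z−μ) > π0·π1·(Φ(z)−Φ(z−μ))² + Φ(z)·Φ(z−μ), where Φ is the standard normal cumulative distribution function. (This inequality is equivalent, via the parametrization α = π0(1−Φ(z))/(1−(π0Φ(z)+π1Φ(z−μ))), to the statement that in the Gaussian two-group model with null N(0,1) and alternative N(μ,1), mFNR*(α) > π1(1−α/π0) for every α∈(0,π0).) -/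
open Real

/-- The standard normal cumulative distribution function `Φ`. -/
noncomputable def stdNormalCDF (z : ℝ) : ℝ :=
  ∫ s in Set.Iic z, (Real.sqrt (2 * Real.pi))⁻¹ * Real.exp (-s ^ 2 / 2)

/-- The density of the standard normal distribution. -/
noncomputable def stdNormalPDF (s : ℝ) : ℝ :=
  (Real.sqrt (2 * Real.pi))⁻¹ * Real.exp (-s ^ 2 / 2)

theorem stdNormalPDF_eq_gaussianPDFReal :
    stdNormalPDF = ProbabilityTheory.gaussianPDFReal 0 1 := by
  ext s
  simp [stdNormalPDF, ProbabilityTheory.gaussianPDFReal]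

theorem stdNormalPDF_nonneg (s : ℝ) : 0 ≤ stdNormalPDF s := by
  unfold stdNormalPDF
  positivity

theorem continuous_stdNormalPDF : Continuous stdNormalPDF := by
  unfold stdNormalPDF
  fun_prop

theorem integrable_stdNormalPDF : MeasureTheory.Integrable stdNormalPDF := by
  rw [stdNormalPDF_eq_gaussianPDFReal]
  exact ProbabilityTheory.integrable_gaussianPDFReal 0 1

theorem stdNormalCDF_nonneg (z : ℝ) : 0 ≤ stdNormalCDF z :=
  MeasureTheory.integral_nonneg stdNormalPDF_nonneg

theorem stdNormalCDF_le_one (z : ℝ) : stdNormalCDF z ≤ 1 := by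
  have h : ∫ s, stdNormalPDF s = 1 := by
    rw [stdNormalPDF_eq_gaussianPDFReal]
    exact ProbabilityTheory.integral_gaussianPDFReal_eq_one 0 one_ne_zero
  rw [← h]
  exact MeasureTheory.setIntegral_le_integral integrable_stdNormalPDF
    (Filter.Eventually.of_forall stdNormalPDF_nonneg)

theorem stdNormalCDF_sub (x y : ℝ) :
    stdNormalCDF y - stdNormalCDF x = ∫ s in x..y, stdNormalPDF s :=
  intervalIntegral.integral_Iic_sub_Iic integrable_stdNormalPDF.integrableOn
    integrable_stdNormalPDF.integrableOn

theorem stdNormalCDF_sub_le {x y C : ℝ} (hxy : x ≤ y)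
    (h : ∀ s ∈ Set.Icc x y, stdNormalPDF s ≤ C) :
    stdNormalCDF y - stdNormalCDF x ≤ (y - x) * C := by
  rw [stdNormalCDF_sub]
  calc ∫ s in x..y, stdNormalPDF s ≤ ∫ _ in x..y, C :=
        intervalIntegral.integral_mono_on hxy (continuous_stdNormalPDF.intervalIntegrable _ _)
          intervalIntegrable_const h
    _ = (y - x) * C := by simp

theorem le_stdNormalCDF_sub {x y C : ℝ} (hxy : x ≤ y)
    (h : ∀ s ∈ Set.Icc x y, C ≤ stdNormalPDF s) :
    (y - x) * C ≤ stdNormalCDF y - stdNormalCDF x := by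
  rw [stdNormalCDF_sub]
  calc (y - x) * C = ∫ _ in x..y, C := by simp
    _ ≤ ∫ s in x..y, stdNormalPDF s :=
        intervalIntegral.integral_mono_on hxy intervalIntegrable_const
          (continuous_stdNormalPDF.intervalIntegrable _ _) h

theorem inv_sqrt_two_pi_lt_one : (Real.sqrt (2 * Real.pi))⁻¹ < 1 := by
  apply inv_lt_one_of_one_lt₀
  rw [Real.lt_sqrt zero_le_one]
  linarith [Real.pi_gt_three]

theorem stdNormalPDF_add_two_le {z s : ℝ} (hs : |s| ≤ |z| + 2) :
    stdNormalPDF (|z| + 2) ≤ stdNormalPDF s := by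
  unfold stdNormalPDF
  gcongr 2
  have h := pow_le_pow_left₀ (abs_nonneg s) hs 2
  rw [sq_abs] at h
  linarith

/-- Near `z`, the density is at most of the order of `e^{-(|z| + 2)² / 4}`. -/
theorem stdNormalPDF_le_exp {z s : ℝ} (hs : |z - s| ≤ 1) :
    stdNormalPDF s ≤
      (Real.sqrt (2 * Real.pi))⁻¹ * Real.exp (9 / 2 - (|z| + 2) ^ 2 / 4) := by
  unfold stdNormalPDF
  gcongr
  have hz : |z| ≤ |s| + 1 := by linarith [abs_sub_abs_le_abs_sub z s]
  nlinarith [sq_abs s, sq_nonneg (|s| - 3), abs_nonneg z, abs_nonneg s]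

/-- **Weak-signal Gaussian model: the trivial rule dominates** (Proposition 3(a)). There is a
universal constant `μ0 > 0` such that for every `μ ∈ (0, μ0)`, every `π0 ∈ (0,1)` (with
`π1 = 1 - π0`) and every `z ∈ ℝ`,
`Φ(z-μ) > π0 π1 (Φ(z) - Φ(z-μ))² + Φ(z) Φ(z-μ)`; equivalently, in the Gaussian two-group
model with null `N(0,1)` and alternative `N(μ,1)`, `mFNR*(α) > π1 (1 - α/π0)` for all
`α ∈ (0, π0)`. -/
theorem gaussian_weak_signal_dominated :
    ∃ μ0 : ℝ, 0 < μ0 ∧ ∀ μ ∈ Set.Ioo (0 : ℝ) μ0, ∀ π0 ∈ Set.Ioo (0 : ℝ) 1, ∀ z : ℝ,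
      π0 * (1 - π0) * (stdNormalCDF z - stdNormalCDF (z - μ)) ^ 2 +
          stdNormalCDF z * stdNormalCDF (z - μ) <
        stdNormalCDF (z - μ) := by
  refine ⟨Real.exp (-5), Real.exp_pos _, ?_⟩
  rintro μ ⟨hμ, hμ5⟩ p ⟨hp, hp1⟩ z
  have hμ1 : μ < 1 := hμ5.trans (Real.exp_lt_one_iff.2 (by norm_num))
  set c := (Real.sqrt (2 * Real.pi))⁻¹
  have hc0 : 0 < c := by positivity
  have hc1 : c < 1 := inv_sqrt_two_pi_lt_one
  set m := stdNormalPDF (|z| + 2) with hm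
  set E := Real.exp (9 / 2 - (|z| + 2) ^ 2 / 4) with hE
  have hm0 : 0 < m := by rw [hm, stdNormalPDF]; positivity
  have hEm : c * E ^ 2 = Real.exp 9 * m := by
    rw [hm, hE, stdNormalPDF, ← Real.exp_nat_mul, mul_left_comm, ← Real.exp_add]
    congr 2
    push_cast
    ring
  have hD0 : 0 ≤ stdNormalCDF z - stdNormalCDF (z - μ) := by
    rw [← mul_zero (z - (z - μ))]
    exact le_stdNormalCDF_sub (by linarith) fun s _ => stdNormalPDF_nonneg s
  have hD : stdNormalCDF z - stdNormalCDF (z - μ) ≤ μ * (c * E) := by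
    have h := stdNormalCDF_sub_le (x := z - μ) (y := z) (C := c * E) (by linarith)
      fun s hs => stdNormalPDF_le_exp (abs_le.2 ⟨by linarith [hs.2], by linarith [hs.1]⟩)
    rwa [sub_sub_cancel] at h
  have ha : m ≤ stdNormalCDF (z - μ) := by
    have h := le_stdNormalCDF_sub (x := z - μ - 1) (y := z - μ) (C := m) (by linarith)
      fun s hs => stdNormalPDF_add_two_le (abs_le.2
        ⟨by linarith [hs.1, neg_abs_le z], by linarith [hs.2, le_abs_self z]⟩)
    linarith [stdNormalCDF_nonneg (z - μ - 1)]
  have hb : m ≤ 1 - stdNormalCDF z := by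
    have h := le_stdNormalCDF_sub (x := z) (y := z + 1) (C := m) (by linarith)
      fun s hs => stdNormalPDF_add_two_le (abs_le.2
        ⟨by linarith [hs.1, neg_abs_le z], by linarith [hs.2, le_abs_self z]⟩)
    linarith [stdNormalCDF_le_one (z + 1)]
  have hμ9 : μ ^ 2 * Real.exp 9 < 1 / 2 := by
    have h1 : μ ^ 2 < Real.exp (-10) := by
      have h := pow_lt_pow_left₀ hμ5 hμ.le two_ne_zero
      rw [← Real.exp_nat_mul] at h
      norm_num at h
      exact h
    have h2 : Real.exp (-10) * Real.exp 9 = (Real.exp 1)⁻¹ := by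
      rw [← Real.exp_add, ← Real.exp_neg]
      norm_num
    have h3 : (Real.exp 1)⁻¹ < 2⁻¹ := by
      gcongr
      linarith [Real.exp_one_gt_d9]
    nlinarith [Real.exp_pos 9]
  have hDm : (stdNormalCDF z - stdNormalCDF (z - μ)) ^ 2 < m / 2 :=
    calc (stdNormalCDF z - stdNormalCDF (z - μ)) ^ 2 ≤ (μ * (c * E)) ^ 2 := by gcongr
      _ = c * (μ ^ 2 * (c * E ^ 2)) := by ring
      _ = c * (μ ^ 2 * Real.exp 9) * m := by rw [hEm]; ring
      _ < 1 * (1 / 2) * m := by gcongr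
      _ = m / 2 := by ring
  generalize stdNormalCDF (z - μ) = a at *
  generalize stdNormalCDF z = y at *
  have hp4 : p * (1 - p) ≤ 1 / 4 := by nlinarith [sq_nonneg (2 * p - 1)]
  have hpD : p * (1 - p) * (y - a) ^ 2 ≤ 1 / 4 * (y - a) ^ 2 := by gcongr
  have hmhalf : m ≤ 1 / 2 := by linarith
  have hDhalf : y - a ≤ 1 / 2 := by nlinarith
  have hab : m / 4 ≤ a * (1 - y) := by
    rcases le_total a (1 - y) with h | h <;> nlinarith
  linarith
end

section
/- For every μ > 0 there exists z0 = z0(μ) ∈ ℝ such that for every z < z0 and every π0∈(0,1) with π1=1−π0: Φ(z−μ) > π0·π1·(Φ(z)−Φ(z−μ))² + Φ(z)·Φ(z−μ), where Φ is the standard normal cumulative distribution function. (Via the parametrization α = π0(1−Φ(z))/(1−(π0Φ(z)+π1Φ(z−μ))), which is decreasing in z, this is equivalent to: in the Gaussian two-group model with null N(0,1) and alternative N(μ,1), there exists α0∈(0,π0) such that mFNR*(α) > π1(1−α/π0) for every α∈(α0,π0).) -/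
open Real

theorem stdNormalDensity_eq_gaussianPDFReal (s : ℝ) :
    (Real.sqrt (2 * Real.pi))⁻¹ * Real.exp (-s ^ 2 / 2) =
      ProbabilityTheory.gaussianPDFReal 0 1 s := by
  simp [ProbabilityTheory.gaussianPDFReal]

theorem integrable_stdNormalDensity :
    MeasureTheory.Integrable
      (fun s : ℝ => (Real.sqrt (2 * Real.pi))⁻¹ * Real.exp (-s ^ 2 / 2)) := by
  simpa only [stdNormalDensity_eq_gaussianPDFReal] using
    ProbabilityTheory.integrable_gaussianPDFReal 0 1

theorem stdNormalCDF_mono : Monotone stdNormalCDF := fun _ _ h =>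
  MeasureTheory.setIntegral_mono_set integrable_stdNormalDensity.integrableOn
    (Filter.Eventually.of_forall fun _ => by positivity) (Set.Iic_subset_Iic.2 h).eventuallyLE

theorem stdNormalCDF_le_exp {z : ℝ} (hz : z ≤ 0) : stdNormalCDF z ≤ Real.exp (-z ^ 2 / 2) := by
  have hint := (ProbabilityTheory.integrable_gaussianPDFReal z 1).const_mul
    (Real.exp (-z ^ 2 / 2))
  calc
    stdNormalCDF z ≤ ∫ s in Set.Iic z,
        Real.exp (-z ^ 2 / 2) * ProbabilityTheory.gaussianPDFReal z 1 s := by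
      refine MeasureTheory.setIntegral_mono_on integrable_stdNormalDensity.integrableOn
        hint.integrableOn measurableSet_Iic fun s hs => ?_
      have hs' : s ≤ z := hs
      simp only [ProbabilityTheory.gaussianPDFReal, NNReal.coe_one, mul_one]
      rw [mul_left_comm, ← Real.exp_add]
      gcongr
      nlinarith [mul_nonneg_of_nonpos_of_nonpos hz (sub_nonpos.2 hs')]
    _ ≤ ∫ s, Real.exp (-z ^ 2 / 2) * ProbabilityTheory.gaussianPDFReal z 1 s :=
      MeasureTheory.setIntegral_le_integral hint (Filter.Eventually.of_forall fun s =>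
        mul_nonneg (Real.exp_pos _).le (ProbabilityTheory.gaussianPDFReal_nonneg z 1 s))
    _ = Real.exp (-z ^ 2 / 2) := by
      rw [MeasureTheory.integral_const_mul,
        ProbabilityTheory.integral_gaussianPDFReal_eq_one z one_ne_zero, mul_one]

theorem exp_div_three_le_stdNormalCDF {y : ℝ} (hy : y ≤ 0) :
    Real.exp (-(y - 1) ^ 2 / 2) / 3 ≤ stdNormalCDF y := by
  have hsqrt : Real.sqrt (2 * Real.pi) ≤ 3 :=
    Real.sqrt_le_iff.2 ⟨by norm_num, by linarith [Real.pi_le_four]⟩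
  have hpos : 0 < Real.sqrt (2 * Real.pi) := by positivity
  calc
    Real.exp (-(y - 1) ^ 2 / 2) / 3 =
        ∫ _ in Set.Icc (y - 1) y, (3 : ℝ)⁻¹ * Real.exp (-(y - 1) ^ 2 / 2) := by
      simp
      ring
    _ ≤ ∫ s in Set.Icc (y - 1) y, (Real.sqrt (2 * Real.pi))⁻¹ * Real.exp (-s ^ 2 / 2) := by
      refine MeasureTheory.setIntegral_mono_on (MeasureTheory.integrableOn_const (by simp))
        integrable_stdNormalDensity.integrableOn measurableSet_Icc fun s hs => ?_
      have hexp : -(y - 1) ^ 2 / 2 ≤ -s ^ 2 / 2 := by nlinarith [hs.1, hs.2]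
      gcongr
    _ ≤ stdNormalCDF y :=
      MeasureTheory.setIntegral_mono_set integrable_stdNormalDensity.integrableOn
        (Filter.Eventually.of_forall fun _ => by positivity) Set.Icc_subset_Iic_self.eventuallyLE

/-- **Gaussian model: small FDR levels are dominated by the trivial rule**
(Proposition 3(b)). For every `μ > 0` there exists `z0 = z0(μ)` such that for every `z < z0`
and every `π0 ∈ (0,1)` (with `π1 = 1 - π0`),
`Φ(z-μ) > π0 π1 (Φ(z) - Φ(z-μ))² + Φ(z) Φ(z-μ)`; equivalently, in the Gaussian two-group
model with null `N(0,1)` and alternative `N(μ,1)`, there exists `α0 ∈ (0, π0)` with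
`mFNR*(α) > π1 (1 - α/π0)` for all `α ∈ (α0, π0)`. -/
theorem gaussian_small_alpha_dominated :
    ∀ μ : ℝ, 0 < μ → ∃ z0 : ℝ, ∀ z < z0, ∀ π0 ∈ Set.Ioo (0 : ℝ) 1,
      π0 * (1 - π0) * (stdNormalCDF z - stdNormalCDF (z - μ)) ^ 2 +
          stdNormalCDF z * stdNormalCDF (z - μ) <
        stdNormalCDF (z - μ) := by
  intro μ hμ
  refine ⟨-(3 * μ + 6), fun z hz p hp => ?_⟩
  have hexp_neg_one : Real.exp (-1) ≤ 1 / 2 := by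
    rw [Real.exp_neg, one_div]
    exact inv_anti₀ (by norm_num) (by linarith [Real.add_one_le_exp (1 : ℝ)])
  have hupper := stdNormalCDF_le_exp (show z ≤ 0 by linarith)
  have hlower := exp_div_three_le_stdNormalCDF (show z - μ ≤ 0 by linarith)
  have hmono : stdNormalCDF (z - μ) ≤ stdNormalCDF z := stdNormalCDF_mono (by linarith)
  have hhalf : Real.exp (-z ^ 2 / 2) ≤ 1 / 2 :=
    (Real.exp_le_exp.2 (by nlinarith)).trans hexp_neg_one
  have hsq : Real.exp (-z ^ 2 / 2) ^ 2 ≤ 1 / 2 * Real.exp (-(z - μ - 1) ^ 2 / 2) := by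
    calc
      Real.exp (-z ^ 2 / 2) ^ 2 ≤ Real.exp (-1) * Real.exp (-(z - μ - 1) ^ 2 / 2) := by
        rw [pow_two, ← Real.exp_add, ← Real.exp_add]
        exact Real.exp_le_exp.2 (by nlinarith)
      _ ≤ _ := by gcongr
  have hpos := Real.exp_pos (-(z - μ - 1) ^ 2 / 2)
  generalize stdNormalCDF z = P at *
  generalize stdNormalCDF (z - μ) = Q at *
  have hQ : 0 < Q := by linarith
  have hP : P ^ 2 ≤ Real.exp (-z ^ 2 / 2) ^ 2 := pow_le_pow_left₀ (by linarith) hupper 2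
  have hdiff : (P - Q) ^ 2 ≤ P ^ 2 := pow_le_pow_left₀ (by linarith) (by linarith) 2
  have hvar : p * (1 - p) * (P - Q) ^ 2 ≤ 1 / 4 * (P - Q) ^ 2 := by
    gcongr
    nlinarith [sq_nonneg (p - 1 / 2)]
  have hPQ : P * Q ≤ 1 / 2 * Q := by
    gcongr
    linarith
  linarith
end
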